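/- Let n ≥ 1, let L¹, L², L³ : ℝ³ → M_n(ℂ) be hermitian-matrix-valued functions of class C³ with sup_z ‖Lⁱ(z)‖/⟨z⟩ < ∞ and sup_z ‖∂^β Lⁱ(z)‖ < ∞ for all multi-indices 1 ≤ |β| ≤ 3, and let M : ℝ³ → M_n(ℂ) be a hermitian-matrix-valued function of class C² with sup_z ‖M(z)‖/⟨z⟩² < ∞, sup_z ‖∂ᵢM(z)‖/⟨z⟩ < ∞ and sup_z ‖∂ᵢ∂_jM(z)‖ < ∞. Then there is a constant C₃ such that for every smooth compactly supported φ : ℝ³ → ℂⁿ, ‖h(h₀φ) − h₀(hφ)‖_{L²} ≤ C₃·‖h₀φ‖_{L²}, where hφ = −(i/2)·Σᵢ [Lⁱ·∂ᵢφ + ∂ᵢ(Lⁱφ)] + M·φ and h₀φ = (1/2)·(−Δφ + |z|²·φ). -/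

import Mathlib

open MeasureTheory

noncomputable section

/-- The partial derivative `∂ᵢf` of a function on `ℝ³`. -/
def pd {F : Type*} [NormedAddCommGroup F] [NormedSpace ℝ F]
    (i : Fin 3) (f : EuclideanSpace ℝ (Fin 3) → F) (z : EuclideanSpace ℝ (Fin 3)) : F :=
  fderiv ℝ f z (EuclideanSpace.single i 1)

/-- The operator `h = (1/2)Σᵢ(Lⁱpᵢ + pᵢLⁱ) + M`, `pᵢ = −i∂ᵢ`, applied to `φ`:
`hφ = −(i/2)Σᵢ[Lⁱ∂ᵢφ + ∂ᵢ(Lⁱφ)] + Mφ`. -/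
def Hop {n : ℕ}
    (L : Fin 3 → EuclideanSpace ℝ (Fin 3) →
      (EuclideanSpace ℂ (Fin n) →L[ℂ] EuclideanSpace ℂ (Fin n)))
    (M : EuclideanSpace ℝ (Fin 3) →
      (EuclideanSpace ℂ (Fin n) →L[ℂ] EuclideanSpace ℂ (Fin n)))
    (φ : EuclideanSpace ℝ (Fin 3) → EuclideanSpace ℂ (Fin n))
    (z : EuclideanSpace ℝ (Fin 3)) : EuclideanSpace ℂ (Fin n) :=
  (-(Complex.I) / 2) • (∑ i : Fin 3, (L i z (pd i φ z) + pd i (fun w => L i w (φ w)) z))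
    + M z (φ z)

/-- The harmonic oscillator Hamiltonian `h₀φ = (1/2)(−Δφ + |z|²φ)`. -/
def H0op {n : ℕ} (φ : EuclideanSpace ℝ (Fin 3) → EuclideanSpace ℂ (Fin n))
    (z : EuclideanSpace ℝ (Fin 3)) : EuclideanSpace ℂ (Fin n) :=
  ((1 : ℝ) / 2) • (-(∑ i : Fin 3, pd i (pd i φ) z) + ‖z‖ ^ 2 • φ z)

open scoped RealInnerProductSpace ContDiff

local notation "ℝ³" => EuclideanSpace ℝ (Fin 3)

section PartialDerivatives

variable {F : Type*} [NormedAddCommGroup F] [NormedSpace ℝ F]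

theorem contDiff_pd {f : ℝ³ → F} {k m : WithTop ℕ∞} (hf : ContDiff ℝ k f) (hm : m + 1 ≤ k)
    (i : Fin 3) : ContDiff ℝ m (pd i f) :=
  (hf.fderiv_right hm).clm_apply contDiff_const

@[fun_prop]
theorem contDiff_infty_pd {f : ℝ³ → F} (hf : ContDiff ℝ ∞ f) (i : Fin 3) :
    ContDiff ℝ ∞ (pd i f) :=
  contDiff_pd hf (by simp) i

theorem pd_eq_zero_of_notMem_tsupport {f : ℝ³ → F} {z : ℝ³} (hz : z ∉ tsupport f) (i : Fin 3) :
    pd i f z = 0 := by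
  have h : fderiv ℝ f z = 0 := by
    by_contra h
    exact hz (support_fderiv_subset ℝ h)
  simp [pd, h]

theorem tsupport_pd_subset (f : ℝ³ → F) (i : Fin 3) : tsupport (pd i f) ⊆ tsupport f := by
  refine closure_minimal (fun z hz => ?_) (isClosed_tsupport f)
  by_contra h
  exact hz (pd_eq_zero_of_notMem_tsupport h i)

theorem pd_comm {f : ℝ³ → F} (hf : ContDiff ℝ 2 f) (i j : Fin 3) (z : ℝ³) :
    pd i (pd j f) z = pd j (pd i f) z := by
  have hd : DifferentiableAt ℝ (fderiv ℝ f) z :=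
    ((hf.fderiv_right (m := 1) (by norm_num)).differentiable (by norm_num)).differentiableAt
  have key : ∀ a b : Fin 3, pd a (pd b f) z =
      fderiv ℝ (fderiv ℝ f) z (EuclideanSpace.single a 1) (EuclideanSpace.single b 1) := by
    intro a b
    change fderiv ℝ (fun w => fderiv ℝ f w (EuclideanSpace.single b 1)) z _ = _
    rw [fderiv_clm_apply hd (differentiableAt_const _)]
    simp
  rw [key, key]
  exact (hf.contDiffAt.isSymmSndFDerivAt (by simp)) _ _

theorem pd_add {f g : ℝ³ → F} (hf : Differentiable ℝ f) (hg : Differentiable ℝ g) (i : Fin 3) :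
    pd i (fun z => f z + g z) = fun z => pd i f z + pd i g z := by
  funext z
  simp [pd, fderiv_fun_add (hf z) (hg z)]

theorem pd_sum {ι : Type*} (s : Finset ι) {f : ι → ℝ³ → F} (hf : ∀ k, Differentiable ℝ (f k))
    (i : Fin 3) : pd i (fun z => ∑ k ∈ s, f k z) = fun z => ∑ k ∈ s, pd i (f k) z := by
  funext z
  simp [pd, fderiv_fun_sum (fun k _ => hf k z)]

theorem pd_neg (f : ℝ³ → F) (i : Fin 3) : pd i (fun z => -f z) = fun z => -pd i f z := by
  funext z
  simp [pd, fderiv_fun_neg]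

theorem pd_const_smul {R : Type*} [Ring R] [Module R F] [SMulCommClass ℝ R F]
    [ContinuousConstSMul R F] {f : ℝ³ → F} (hf : Differentiable ℝ f) (c : R) (i : Fin 3) :
    pd i (fun z => c • f z) = fun z => c • pd i f z := by
  funext z
  simp [pd, fderiv_fun_const_smul (hf z) c]

theorem pd_smul {c : ℝ³ → ℝ} {f : ℝ³ → F} (hc : Differentiable ℝ c) (hf : Differentiable ℝ f)
    (i : Fin 3) : pd i (fun z => c z • f z) = fun z => c z • pd i f z + pd i c z • f z := by
  funext z
  simp [pd, fderiv_fun_smul (hc z) (hf z)]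

theorem pd_coord (i : Fin 3) : pd i (fun z : ℝ³ => z i) = fun _ => (1 : ℝ) := by
  funext z
  have h : HasFDerivAt (fun z : ℝ³ => z i) (EuclideanSpace.proj i : ℝ³ →L[ℝ] ℝ) z :=
    (EuclideanSpace.proj i : ℝ³ →L[ℝ] ℝ).hasFDerivAt
  simp [pd, h.fderiv]

theorem pd_norm_sq (i : Fin 3) : pd i (fun z : ℝ³ => ‖z‖ ^ 2) = fun z => 2 * z i := by
  funext z
  simp [pd, fderiv_norm_sq_apply, EuclideanSpace.inner_single_right]

end PartialDerivatives

section Energy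

theorem integrable_of_eq_zero_off_tsupport {F : Type*} [NormedAddCommGroup F]
    {φ : ℝ³ → F} (hc : HasCompactSupport φ) {u : ℝ³ → ℝ} (hu : Continuous u)
    (h : ∀ z, z ∉ tsupport φ → u z = 0) : Integrable u :=
  hu.integrable_of_hasCompactSupport (HasCompactSupport.intro hc h)

variable {V : Type*} [NormedAddCommGroup V] [InnerProductSpace ℝ V]

theorem integral_inner_pd {f g : ℝ³ → V} (hf : ContDiff ℝ 1 f) (hg : ContDiff ℝ 1 g)
    (hc : HasCompactSupport f) (i : Fin 3) :
    ∫ z, ⟪pd i f z, g z⟫ = -∫ z, ⟪f z, pd i g z⟫ := by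
  have hf' : Continuous (pd i f) := (contDiff_pd (m := 0) hf (by norm_num) i).continuous
  have hg' : Continuous (pd i g) := (contDiff_pd (m := 0) hg (by norm_num) i).continuous
  have integrable : ∀ {a b : ℝ³ → V}, Continuous a → Continuous b →
      tsupport a ⊆ tsupport f → Integrable (fun z => innerSL ℝ (a z) (b z)) := by
    intro a b ha hb hs
    refine Continuous.integrable_of_hasCompactSupport (by simpa using ha.inner hb) ?_
    refine HasCompactSupport.intro hc fun z hz => ?_
    simp [image_eq_zero_of_notMem_tsupport (fun h => hz (hs h))]
  have h := integral_bilinear_fderiv_right_eq_neg_left_of_integrable (μ := volume)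
    (v := (EuclideanSpace.single i 1 : ℝ³)) (B := innerSL ℝ (E := V)) (f := f) (g := g)
    (integrable hf' hg.continuous (tsupport_pd_subset f i))
    (integrable hf.continuous hg' subset_rfl)
    (integrable hf.continuous hg.continuous subset_rfl)
    (fun x _ => (hf.differentiable (by norm_num)).differentiableAt)
    (fun x _ => (hg.differentiable (by norm_num)).differentiableAt)
  exact (neg_eq_iff_eq_neg.2 h).symm

variable {φ : ℝ³ → V}

theorem integral_inner_pd_pd_self (hφ : ContDiff ℝ ∞ φ) (hc : HasCompactSupport φ) (i : Fin 3) :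
    ∫ z, ⟪φ z, pd i (pd i φ) z⟫ = -∫ z, ‖pd i φ z‖ ^ 2 := by
  have h := integral_inner_pd (hφ.of_le (by simp)) (g := pd i φ)
    ((contDiff_infty_pd hφ i).of_le (by simp)) hc i
  simp only [real_inner_self_eq_norm_sq] at h
  linarith

theorem integral_inner_coord_smul_pd (hφ : ContDiff ℝ ∞ φ) (hc : HasCompactSupport φ)
    (i : Fin 3) : ∫ z : ℝ³, z i * ⟪pd i φ z, φ z⟫ = -(1 / 2) * ∫ z, ‖φ z‖ ^ 2 := by
  have hx : ContDiff ℝ ∞ (fun z : ℝ³ => z i) := by fun_prop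
  have h := integral_inner_pd (hφ.of_le (by simp)) (g := fun z => z i • φ z)
    ((hx.smul hφ).of_le (by simp)) hc i
  rw [pd_smul (hx.differentiable (by simp)) (hφ.differentiable (by simp)), pd_coord] at h
  simp only [inner_smul_right, inner_add_right, one_smul, real_inner_self_eq_norm_sq] at h
  have h1 : Integrable (fun z : ℝ³ => z i * ⟪φ z, pd i φ z⟫) :=
    integrable_of_eq_zero_off_tsupport hc
      (hx.continuous.mul (hφ.continuous.inner (contDiff_infty_pd hφ i).continuous))
      fun z hz => by simp [image_eq_zero_of_notMem_tsupport hz]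
  have h2 : Integrable (fun z : ℝ³ => ‖φ z‖ ^ 2) :=
    integrable_of_eq_zero_off_tsupport hc (hφ.continuous.norm.pow 2)
      fun z hz => by simp [image_eq_zero_of_notMem_tsupport hz]
  rw [integral_add h1 h2] at h
  simp_rw [real_inner_comm (pd i φ _) (φ _)] at h ⊢
  linarith

theorem integral_norm_sq_mul_inner_pd_pd (hφ : ContDiff ℝ ∞ φ) (hc : HasCompactSupport φ)
    (i : Fin 3) : ∫ z : ℝ³, ‖z‖ ^ 2 * ⟪pd i (pd i φ) z, φ z⟫ =
      (∫ z, ‖φ z‖ ^ 2) - ∫ z : ℝ³, ‖z‖ ^ 2 * ‖pd i φ z‖ ^ 2 := by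
  have hx : ContDiff ℝ ∞ (fun z : ℝ³ => ‖z‖ ^ 2) := contDiff_norm_sq ℝ
  have hd := contDiff_infty_pd hφ i
  have h := integral_inner_pd (hd.of_le (by simp)) (g := fun z : ℝ³ => ‖z‖ ^ 2 • φ z)
    ((hx.smul hφ).of_le (by simp)) (hc.mono' (subset_closure.trans (tsupport_pd_subset φ i))) i
  rw [pd_smul (hx.differentiable (by simp)) (hφ.differentiable (by simp)), pd_norm_sq] at h
  simp only [inner_smul_right, inner_add_right, real_inner_self_eq_norm_sq, mul_assoc] at h
  have h1 : Integrable (fun z : ℝ³ => ‖z‖ ^ 2 * ‖pd i φ z‖ ^ 2) :=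
    integrable_of_eq_zero_off_tsupport hc (hx.continuous.mul (hd.continuous.norm.pow 2))
      fun z hz => by simp [pd_eq_zero_of_notMem_tsupport hz]
  have h2 : Integrable (fun z : ℝ³ => 2 * (z i * ⟪pd i φ z, φ z⟫)) :=
    integrable_of_eq_zero_off_tsupport hc
      (continuous_const.mul (Continuous.mul (by fun_prop) (hd.continuous.inner hφ.continuous)))
      fun z hz => by simp [image_eq_zero_of_notMem_tsupport hz]
  rw [integral_add h1 h2, integral_const_mul, integral_inner_coord_smul_pd hφ hc] at h
  linarith

theorem integral_inner_pd_pd_pd_pd (hφ : ContDiff ℝ ∞ φ) (hc : HasCompactSupport φ)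
    (i j : Fin 3) : ∫ z, ⟪pd i (pd i φ) z, pd j (pd j φ) z⟫ = ∫ z, ‖pd i (pd j φ) z‖ ^ 2 := by
  have hi := contDiff_infty_pd hφ i
  have hij := contDiff_infty_pd (contDiff_infty_pd hφ j) i
  have hjj := contDiff_infty_pd (contDiff_infty_pd hφ j) j
  have hci : HasCompactSupport (pd i φ) :=
    hc.mono' (subset_closure.trans (tsupport_pd_subset φ i))
  have hcomm : pd j (pd i φ) = pd i (pd j φ) :=
    funext fun z => pd_comm (contDiff_infty.1 hφ 2) j i z
  have h1 := integral_inner_pd (hi.of_le (by simp)) (g := pd j (pd j φ))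
    (hjj.of_le (by simp)) hci i
  have h2 := integral_inner_pd (hi.of_le (by simp)) (g := pd i (pd j φ))
    (hij.of_le (by simp)) hci j
  rw [hcomm] at h2
  have h3 : pd i (pd j (pd j φ)) = pd j (pd i (pd j φ)) :=
    funext fun z => pd_comm (contDiff_infty.1 (contDiff_infty_pd hφ j) 2) i j z
  rw [h3] at h1
  simp only [real_inner_self_eq_norm_sq] at h2
  linarith

theorem integral_graph_norm_le (hφ : ContDiff ℝ ∞ φ) (hc : HasCompactSupport φ) :
    ∫ z : ℝ³, ((∑ i, ∑ j, ‖pd i (pd j φ) z‖ ^ 2) + (1 + ‖z‖ ^ 2) * ∑ i, ‖pd i φ z‖ ^ 2 +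
        (1 + ‖z‖ ^ 2) ^ 2 * ‖φ z‖ ^ 2) ≤
      3 * ∫ z : ℝ³, ‖-(∑ i, pd i (pd i φ) z) + ‖z‖ ^ 2 • φ z‖ ^ 2 := by
  have c0 : Continuous φ := hφ.continuous
  have c1 : ∀ i, Continuous (pd i φ) := fun i => (contDiff_infty_pd hφ i).continuous
  have c2 : ∀ i j, Continuous (pd i (pd j φ)) := fun i j =>
    (contDiff_infty_pd (contDiff_infty_pd hφ j) i).continuous
  have z0 : ∀ z, z ∉ tsupport φ → φ z = 0 := fun z hz => image_eq_zero_of_notMem_tsupport hz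
  have z1 : ∀ i z, z ∉ tsupport φ → pd i φ z = 0 := fun i z hz =>
    pd_eq_zero_of_notMem_tsupport hz i
  have z2 : ∀ i j z, z ∉ tsupport φ → pd i (pd j φ) z = 0 := fun i j z hz =>
    pd_eq_zero_of_notMem_tsupport (fun h => hz (tsupport_pd_subset φ j h)) i
  have int {u : ℝ³ → ℝ} (hu : Continuous u) (h : ∀ z, z ∉ tsupport φ → u z = 0) :
      Integrable u := integrable_of_eq_zero_off_tsupport hc hu h
  have iN : Integrable fun z => ‖φ z‖ ^ 2 := int (by fun_prop) fun z hz => by simp [z0 z hz]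
  have iB : Integrable fun z : ℝ³ => ‖z‖ ^ 2 * ‖φ z‖ ^ 2 :=
    int (by fun_prop) fun z hz => by simp [z0 z hz]
  have iZ : Integrable fun z : ℝ³ => ‖z‖ ^ 4 * ‖φ z‖ ^ 2 :=
    int (by fun_prop) fun z hz => by simp [z0 z hz]
  have iA : ∀ i, Integrable fun z => ‖pd i φ z‖ ^ 2 := fun i =>
    int (by fun_prop) fun z hz => by simp [z1 i z hz]
  have iC : ∀ i, Integrable fun z : ℝ³ => ‖z‖ ^ 2 * ‖pd i φ z‖ ^ 2 := fun i =>
    int (by fun_prop) fun z hz => by simp [z1 i z hz]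
  have iD : ∀ i j, Integrable fun z => ‖pd i (pd j φ) z‖ ^ 2 := fun i j =>
    int (by fun_prop) fun z hz => by simp [z2 i j z hz]
  have iH : Integrable fun z : ℝ³ => ‖-(∑ i, pd i (pd i φ) z) + ‖z‖ ^ 2 • φ z‖ ^ 2 :=
    int (by fun_prop) fun z hz => by simp [z2 _ _ z hz, z0 z hz]
  have iE : ∀ i j, Integrable fun z => ⟪pd i (pd i φ) z, pd j (pd j φ) z⟫ := fun i j =>
    int (by fun_prop) fun z hz => by simp [z2 _ _ z hz]
  have iF : ∀ i, Integrable fun z : ℝ³ => ‖z‖ ^ 2 * ⟪pd i (pd i φ) z, φ z⟫ := fun i =>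
    int (by fun_prop) fun z hz => by simp [z2 _ _ z hz]
  have iG : ∀ i, Integrable fun z => ⟪φ z, pd i (pd i φ) z⟫ := fun i =>
    int (by fun_prop) fun z hz => by simp [z2 _ _ z hz]
  have iK : ∀ i, Integrable fun z : ℝ³ => z i * ⟪pd i φ z, φ z⟫ := fun i =>
    int (by fun_prop) fun z hz => by simp [z0 z hz]
  set N := ∫ z, ‖φ z‖ ^ 2
  set B := ∫ z : ℝ³, ‖z‖ ^ 2 * ‖φ z‖ ^ 2
  set Z := ∫ z : ℝ³, ‖z‖ ^ 4 * ‖φ z‖ ^ 2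
  set A := ∑ i, ∫ z, ‖pd i φ z‖ ^ 2
  set C := ∑ i, ∫ z : ℝ³, ‖z‖ ^ 2 * ‖pd i φ z‖ ^ 2
  set D := ∑ i, ∑ j, ∫ z, ‖pd i (pd j φ) z‖ ^ 2
  set H := ∫ z : ℝ³, ‖-(∑ i, pd i (pd i φ) z) + ‖z‖ ^ 2 • φ z‖ ^ 2 with hH
  have nonneg_B : 0 ≤ B := integral_nonneg fun z => by positivity
  have nonneg_A : 0 ≤ A := Finset.sum_nonneg fun i _ => integral_nonneg fun z => by positivity
  have nonneg_C : 0 ≤ C := Finset.sum_nonneg fun i _ => integral_nonneg fun z => by positivity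
  have uncertainty : 3 * N ≤ A + B := by
    have h : 0 ≤ ∫ z : ℝ³, ((∑ i, ‖pd i φ z‖ ^ 2) + ‖z‖ ^ 2 * ‖φ z‖ ^ 2 +
        2 * ∑ i, z i * ⟪pd i φ z, φ z⟫) := by
      refine integral_nonneg fun z => ?_
      have e : (∑ i, ‖pd i φ z‖ ^ 2) + ‖z‖ ^ 2 * ‖φ z‖ ^ 2 +
          2 * ∑ i, z i * ⟪pd i φ z, φ z⟫ = ∑ i, ‖pd i φ z + z i • φ z‖ ^ 2 := by
        simp only [norm_add_sq_real, inner_smul_right, norm_smul, mul_pow, Real.norm_eq_abs, sq_abs,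
          Finset.sum_add_distrib, EuclideanSpace.norm_sq_eq, Finset.sum_mul, Finset.mul_sum]
        ring
      simp only [e, Pi.zero_apply]
      positivity
    have iA' := integrable_finsetSum Finset.univ fun i _ => iA i
    have iK' := (integrable_finsetSum Finset.univ fun i _ => iK i).const_mul 2
    rw [integral_add (iA'.fun_add iB) iK', integral_add iA' iB, integral_const_mul,
      integral_finsetSum _ fun i _ => iA i, integral_finsetSum _ fun i _ => iK i] at h
    simp only [integral_inner_coord_smul_pd hφ hc, Finset.sum_const, Finset.card_univ,
      Fintype.card_fin, nsmul_eq_mul] at h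
    push_cast at h
    linarith
  have energy : A + B ≤ 3 / 2 * N + 1 / 6 * H := by
    have h : ∫ z : ℝ³, (‖z‖ ^ 2 * ‖φ z‖ ^ 2 - ∑ i, ⟪φ z, pd i (pd i φ) z⟫) ≤
        ∫ z : ℝ³, (3 / 2 * ‖φ z‖ ^ 2 +
          1 / 6 * ‖-(∑ i, pd i (pd i φ) z) + ‖z‖ ^ 2 • φ z‖ ^ 2) := by
      refine integral_mono (iB.sub (integrable_finsetSum Finset.univ fun i _ => iG i))
        ((iN.const_mul _).fun_add (iH.const_mul _)) fun z => ?_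
      have e : ‖z‖ ^ 2 * ‖φ z‖ ^ 2 - ∑ i, ⟪φ z, pd i (pd i φ) z⟫ =
          ⟪φ z, -(∑ i, pd i (pd i φ) z) + ‖z‖ ^ 2 • φ z⟫ := by
        rw [inner_add_right, inner_neg_right, inner_sum, inner_smul_right,
          real_inner_self_eq_norm_sq]
        ring
      have := real_inner_le_norm (φ z) (-(∑ i, pd i (pd i φ) z) + ‖z‖ ^ 2 • φ z)
      simp only [e]
      nlinarith [sq_nonneg (3 * ‖φ z‖ - ‖-(∑ i, pd i (pd i φ) z) + ‖z‖ ^ 2 • φ z‖)]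
    rw [integral_sub iB (integrable_finsetSum Finset.univ fun i _ => iG i),
      integral_finsetSum _ fun i _ => iG i, integral_add (iN.const_mul _) (iH.const_mul _),
      integral_const_mul, integral_const_mul] at h
    simp only [integral_inner_pd_pd_self hφ hc, Finset.sum_neg_distrib] at h
    linarith
  have expansion : H = D + 2 * C - 6 * N + Z := by
    have e : ∀ z : ℝ³, ‖-(∑ i, pd i (pd i φ) z) + ‖z‖ ^ 2 • φ z‖ ^ 2 =
        (∑ i, ∑ j, ⟪pd i (pd i φ) z, pd j (pd j φ) z⟫) -
          2 * (∑ i, ‖z‖ ^ 2 * ⟪pd i (pd i φ) z, φ z⟫) + ‖z‖ ^ 4 * ‖φ z‖ ^ 2 := by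
      intro z
      rw [norm_add_sq_real, norm_neg, ← real_inner_self_eq_norm_sq (∑ i, pd i (pd i φ) z),
        sum_inner, inner_neg_left, sum_inner, norm_smul]
      simp only [inner_sum, inner_smul_right, norm_pow, norm_norm]
      ring
    have iE' := integrable_finsetSum Finset.univ fun i _ =>
      integrable_finsetSum Finset.univ fun j _ => iE i j
    have iF' := (integrable_finsetSum Finset.univ fun i _ => iF i).const_mul 2
    rw [hH]
    simp_rw [e]
    rw [integral_add (iE'.sub' iF') iZ, integral_sub iE' iF', integral_const_mul,
      integral_finsetSum _ fun i _ => iF i,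
      integral_finsetSum _ fun i _ => integrable_finsetSum Finset.univ fun j _ => iE i j]
    simp_rw [fun i => integral_finsetSum Finset.univ fun j (_ : j ∈ Finset.univ) => iE i j,
      integral_inner_pd_pd_pd_pd hφ hc, integral_norm_sq_mul_inner_pd_pd hφ hc]
    simp only [Finset.sum_sub_distrib, Finset.sum_const, Finset.card_univ, Fintype.card_fin,
      nsmul_eq_mul]
    push_cast
    ring
  have total : ∫ z : ℝ³, ((∑ i, ∑ j, ‖pd i (pd j φ) z‖ ^ 2) +
      (1 + ‖z‖ ^ 2) * ∑ i, ‖pd i φ z‖ ^ 2 + (1 + ‖z‖ ^ 2) ^ 2 * ‖φ z‖ ^ 2) =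
        D + A + C + N + 2 * B + Z := by
    have iD' := integrable_finsetSum Finset.univ fun i _ =>
      integrable_finsetSum Finset.univ fun j _ => iD i j
    have iA' := integrable_finsetSum Finset.univ fun i _ => iA i
    have iC' := integrable_finsetSum Finset.univ fun i _ => iC i
    have e : ∀ z : ℝ³, (∑ i, ∑ j, ‖pd i (pd j φ) z‖ ^ 2) +
        (1 + ‖z‖ ^ 2) * ∑ i, ‖pd i φ z‖ ^ 2 + (1 + ‖z‖ ^ 2) ^ 2 * ‖φ z‖ ^ 2 =
        (∑ i, ∑ j, ‖pd i (pd j φ) z‖ ^ 2) + (∑ i, ‖pd i φ z‖ ^ 2) +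
        (∑ i, ‖z‖ ^ 2 * ‖pd i φ z‖ ^ 2) + ‖φ z‖ ^ 2 + 2 * (‖z‖ ^ 2 * ‖φ z‖ ^ 2) +
        ‖z‖ ^ 4 * ‖φ z‖ ^ 2 := by
      intro z
      rw [← Finset.mul_sum]
      ring
    simp_rw [e]
    rw [integral_add ((((iD'.fun_add iA').fun_add iC').fun_add iN).fun_add (iB.const_mul 2)) iZ,
      integral_add (((iD'.fun_add iA').fun_add iC').fun_add iN) (iB.const_mul 2),
      integral_add ((iD'.fun_add iA').fun_add iC') iN, integral_add (iD'.fun_add iA') iC',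
      integral_add iD' iA', integral_const_mul,
      integral_finsetSum _ fun i _ => iA i, integral_finsetSum _ fun i _ => iC i,
      integral_finsetSum _ fun i _ => integrable_finsetSum Finset.univ fun j _ => iD i j]
    simp_rw [fun i => integral_finsetSum Finset.univ fun j (_ : j ∈ Finset.univ) => iD i j]
    rfl
  rw [total]
  linarith

end Energy

section Commutator

variable {n : ℕ}

local notation "ℂⁿ" => EuclideanSpace ℂ (Fin n)

theorem differentiable_clm_apply {A : ℝ³ → ℂⁿ →L[ℂ] ℂⁿ} {ψ : ℝ³ → ℂⁿ} (hA : Differentiable ℝ A)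
    (hψ : Differentiable ℝ ψ) : Differentiable ℝ fun z => A z (ψ z) := fun z =>
  ((ContinuousLinearMap.restrictScalarsL ℂ ℂⁿ ℂⁿ ℝ ℝ).hasFDerivAt_of_bilinear
    (hA z).hasFDerivAt (hψ z).hasFDerivAt).differentiableAt

theorem contDiff_clm_apply {A : ℝ³ → ℂⁿ →L[ℂ] ℂⁿ} {ψ : ℝ³ → ℂⁿ} {k : WithTop ℕ∞}
    (hA : ContDiff ℝ k A) (hψ : ContDiff ℝ k ψ) : ContDiff ℝ k fun z => A z (ψ z) :=
  ((ContinuousLinearMap.restrictScalarsL ℂ ℂⁿ ℂⁿ ℝ ℝ).contDiff.comp hA).clm_apply hψ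

theorem pd_clm_apply {A : ℝ³ → ℂⁿ →L[ℂ] ℂⁿ} {ψ : ℝ³ → ℂⁿ} (hA : Differentiable ℝ A)
    (hψ : Differentiable ℝ ψ) (i : Fin 3) :
    pd i (fun z => A z (ψ z)) = fun z => A z (pd i ψ z) + pd i A z (ψ z) := by
  funext z
  have h := (ContinuousLinearMap.restrictScalarsL ℂ ℂⁿ ℂⁿ ℝ ℝ).hasFDerivAt_of_bilinear
    (hA z).hasFDerivAt (hψ z).hasFDerivAt
  exact DFunLike.congr_fun h.fderiv _

theorem pd_pd_clm_apply {A : ℝ³ → ℂⁿ →L[ℂ] ℂⁿ} {ψ : ℝ³ → ℂⁿ} (hA : ContDiff ℝ 2 A)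
    (hψ : ContDiff ℝ 2 ψ) (i : Fin 3) (z : ℝ³) :
    pd i (pd i fun z => A z (ψ z)) z =
      A z (pd i (pd i ψ) z) + (2 : ℝ) • pd i A z (pd i ψ z) + pd i (pd i A) z (ψ z) := by
  have hA₁ := hA.differentiable (by norm_num)
  have hψ₁ := hψ.differentiable (by norm_num)
  have hA₂ : Differentiable ℝ (pd i A) :=
    (contDiff_pd (m := 1) hA (by norm_num) i).differentiable (by norm_num)
  have hψ₂ : Differentiable ℝ (pd i ψ) :=
    (contDiff_pd (m := 1) hψ (by norm_num) i).differentiable (by norm_num)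
  rw [pd_clm_apply hA₁ hψ₁, pd_add (differentiable_clm_apply hA₁ hψ₂)
    (differentiable_clm_apply hA₂ hψ₁), pd_clm_apply hA₁ hψ₂, pd_clm_apply hA₂ hψ₁]
  simp only [two_smul]
  abel

theorem H0op_clm_apply {A : ℝ³ → ℂⁿ →L[ℂ] ℂⁿ} {ψ : ℝ³ → ℂⁿ} (hA : ContDiff ℝ 2 A)
    (hψ : ContDiff ℝ 2 ψ) (z : ℝ³) :
    H0op (fun z => A z (ψ z)) z = A z (H0op ψ z) -
      ((1 / 2 : ℝ) • ∑ j, pd j (pd j A) z (ψ z) + ∑ j, pd j A z (pd j ψ z)) := by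
  have hreal : ∀ (r : ℝ) (v : ℂⁿ), A z (r • v) = r • A z v := fun r v =>
    (A z).map_smul_of_tower r v
  simp only [H0op, pd_pd_clm_apply hA hψ, Finset.sum_add_distrib, hreal, map_add, map_neg,
    map_sum, ← Finset.smul_sum]
  module

theorem H0op_add {f g : ℝ³ → ℂⁿ} (hf : ContDiff ℝ 2 f) (hg : ContDiff ℝ 2 g) (z : ℝ³) :
    H0op (fun z => f z + g z) z = H0op f z + H0op g z := by
  have h (i : Fin 3) := pd_add ((contDiff_pd (m := 1) hf (by norm_num) i).differentiable
    (by norm_num)) ((contDiff_pd (m := 1) hg (by norm_num) i).differentiable (by norm_num)) i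
  simp only [H0op, pd_add (hf.differentiable (by norm_num)) (hg.differentiable (by norm_num)), h,
    Finset.sum_add_distrib]
  module

theorem H0op_sum {ι : Type*} (s : Finset ι) {f : ι → ℝ³ → ℂⁿ} (hf : ∀ k, ContDiff ℝ 2 (f k))
    (z : ℝ³) : H0op (fun z => ∑ k ∈ s, f k z) z = ∑ k ∈ s, H0op (f k) z := by
  have h (i : Fin 3) := pd_sum s (fun k => (contDiff_pd (m := 1) (hf k) (by norm_num)
    i).differentiable (by norm_num)) i
  simp only [H0op, pd_sum s fun k => (hf k).differentiable (by norm_num), h, smul_add, smul_neg,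
    Finset.sum_add_distrib, Finset.smul_sum, Finset.sum_neg_distrib]
  rw [Finset.sum_comm]

theorem contDiff_H0op {φ : ℝ³ → ℂⁿ} (hφ : ContDiff ℝ ∞ φ) : ContDiff ℝ ∞ (H0op φ) := by
  have hx : ContDiff ℝ ∞ (fun z : ℝ³ => ‖z‖ ^ 2) := contDiff_norm_sq ℝ
  unfold H0op
  exact ((ContDiff.sum fun i _ => contDiff_infty_pd (contDiff_infty_pd hφ i) i).neg.add
    (hx.smul hφ)).const_smul _

theorem pd_H0op {φ : ℝ³ → ℂⁿ} (hφ : ContDiff ℝ ∞ φ) (i : Fin 3) (z : ℝ³) :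
    pd i (H0op φ) z = H0op (pd i φ) z + z i • φ z := by
  have hx : ContDiff ℝ ∞ (fun z : ℝ³ => ‖z‖ ^ 2) := contDiff_norm_sq ℝ
  have hjj (j : Fin 3) : ContDiff ℝ ∞ (pd j (pd j φ)) :=
    contDiff_infty_pd (contDiff_infty_pd hφ j) j
  have hsum : ContDiff ℝ ∞ fun z => ∑ j, pd j (pd j φ) z := ContDiff.sum fun j _ => hjj j
  have hxφ : ContDiff ℝ ∞ fun z => ‖z‖ ^ 2 • φ z := hx.smul hφ
  have hadd : ContDiff ℝ ∞ fun z => -(∑ j, pd j (pd j φ) z) + ‖z‖ ^ 2 • φ z := hsum.neg.add hxφ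
  have hcomm (j : Fin 3) : pd i (pd j (pd j φ)) = pd j (pd j (pd i φ)) := by
    rw [funext (pd_comm (contDiff_infty.1 hφ 2) j i : ∀ z, _),
      funext (pd_comm (contDiff_infty.1 (contDiff_infty_pd hφ j) 2) j i : ∀ z, _)]
  have h1 : pd i (H0op φ) = fun z => ((1 : ℝ) / 2) • (-(∑ j, pd i (pd j (pd j φ)) z) +
      (‖z‖ ^ 2 • pd i φ z + (2 * z i) • φ z)) := by
    unfold H0op
    rw [pd_const_smul (hadd.differentiable (by simp)),
      pd_add (hsum.neg.differentiable (by simp)) (hxφ.differentiable (by simp)),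
      pd_neg, pd_sum _ (fun j => (hjj j).differentiable (by simp)),
      pd_smul (hx.differentiable (by simp)) (hφ.differentiable (by simp)), pd_norm_sq]
  simp only [h1, hcomm, H0op]
  module

theorem Hop_eq_sum_add {L : Fin 3 → ℝ³ → ℂⁿ →L[ℂ] ℂⁿ} {M : ℝ³ → ℂⁿ →L[ℂ] ℂⁿ}
    (hL : ∀ i, Differentiable ℝ (L i)) {ψ : ℝ³ → ℂⁿ}
    (hψ : Differentiable ℝ ψ) (z : ℝ³) :
    Hop L M ψ z = ∑ i, (-Complex.I • L i z) (pd i ψ z) +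
      (M z + (-Complex.I / 2) • ∑ i, pd i (L i) z) (ψ z) := by
  have h (i : Fin 3) := pd_clm_apply (hL i) hψ i
  simp only [Hop, h, add_apply, smul_apply,
    sum_apply, ← Finset.smul_sum, Finset.sum_add_distrib]
  module

theorem commutator_eq {L : Fin 3 → ℝ³ → ℂⁿ →L[ℂ] ℂⁿ} {M : ℝ³ → ℂⁿ →L[ℂ] ℂⁿ}
    {P : Fin 3 → ℝ³ → ℂⁿ →L[ℂ] ℂⁿ} {W : ℝ³ → ℂⁿ →L[ℂ] ℂⁿ}
    (hP : ∀ i, ContDiff ℝ 2 (P i)) (hW : ContDiff ℝ 2 W)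
    (hLM : ∀ ψ : ℝ³ → ℂⁿ, Differentiable ℝ ψ →
      Hop L M ψ = fun z => ∑ i, P i z (pd i ψ z) + W z (ψ z))
    {φ : ℝ³ → ℂⁿ} (hφ : ContDiff ℝ ∞ φ) (z : ℝ³) :
    Hop L M (H0op φ) z - H0op (Hop L M φ) z =
      ∑ i, (P i z (z i • φ z) + ((1 / 2 : ℝ) • ∑ j, pd j (pd j (P i)) z (pd i φ z) +
        ∑ j, pd j (P i) z (pd j (pd i φ) z))) +
      ((1 / 2 : ℝ) • ∑ j, pd j (pd j W) z (φ z) + ∑ j, pd j W z (pd j φ z)) := by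
  have hφ₂ : ContDiff ℝ 2 φ := contDiff_infty.1 hφ 2
  have hpd (i : Fin 3) : ContDiff ℝ 2 (pd i φ) := contDiff_infty.1 (contDiff_infty_pd hφ i) 2
  have hPφ (i : Fin 3) := contDiff_clm_apply (hP i) (hpd i)
  rw [hLM _ ((contDiff_H0op hφ).differentiable (by simp)), hLM _ (hφ.differentiable (by simp)),
    H0op_add (ContDiff.sum fun i _ => hPφ i) (contDiff_clm_apply hW hφ₂), H0op_sum _ hPφ,
    H0op_clm_apply hW hφ₂]
  simp only [fun i => H0op_clm_apply (hP i) (hpd i), pd_H0op hφ, map_add, Finset.sum_add_distrib,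
    Finset.sum_sub_distrib]
  abel

theorem norm_half_smul_sum_le {𝕜 E : Type*} [NormedField 𝕜] [SeminormedAddCommGroup E]
    [NormedSpace 𝕜 E] {r : 𝕜} (hr : ‖r‖ = 1 / 2) {u : Fin 3 → E} {c : ℝ} (hu : ∀ j, ‖u j‖ ≤ c) :
    ‖r • ∑ j, u j‖ ≤ 3 / 2 * c := by
  have := norm_sum_le_of_le Finset.univ fun j _ => hu j
  simp only [Finset.sum_const, Finset.card_univ, Fintype.card_fin, nsmul_eq_mul] at this
  push_cast at this
  rw [norm_smul, hr]
  linarith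

theorem norm_commutator_term_le {P : ℝ³ → ℂⁿ →L[ℂ] ℂⁿ} {K : ℝ} {z : ℝ³}
    (hP₀ : ‖P z‖ ≤ K * √(‖z‖ ^ 2 + 1)) (hP₁ : ∀ j, ‖pd j P z‖ ≤ K)
    (hP₂ : ∀ j, ‖pd j (pd j P) z‖ ≤ K) (φ : ℝ³ → ℂⁿ) (i : Fin 3) :
    ‖P z (z i • φ z) + ((1 / 2 : ℝ) • ∑ j, pd j (pd j P) z (pd i φ z) +
        ∑ j, pd j P z (pd j (pd i φ) z))‖ ≤
      K * √(‖z‖ ^ 2 + 1) ^ 2 * ‖φ z‖ +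
        (3 / 2 * (K * ‖pd i φ z‖) + ∑ j, K * ‖pd j (pd i φ) z‖) := by
  refine norm_add_le_of_le ?_ (norm_add_le_of_le
    (norm_half_smul_sum_le (by norm_num) fun j => (pd j (pd j P) z).le_of_opNorm_le (hP₂ j) _)
    (norm_sum_le_of_le _ fun j _ => (pd j P z).le_of_opNorm_le (hP₁ j) _))
  have hK : 0 ≤ K := (norm_nonneg _).trans (hP₁ 0)
  have hz : ‖z i‖ ≤ √(‖z‖ ^ 2 + 1) :=
    (PiLp.norm_apply_le z i).trans (Real.le_sqrt_of_sq_le (by linarith))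
  refine ((P z).le_of_opNorm_le hP₀ _).trans ?_
  rw [norm_smul]
  calc K * √(‖z‖ ^ 2 + 1) * (‖z i‖ * ‖φ z‖)
      ≤ K * √(‖z‖ ^ 2 + 1) * (√(‖z‖ ^ 2 + 1) * ‖φ z‖) := by gcongr
    _ = K * √(‖z‖ ^ 2 + 1) ^ 2 * ‖φ z‖ := by ring

theorem norm_commutator_le {L : Fin 3 → ℝ³ → ℂⁿ →L[ℂ] ℂⁿ} {M : ℝ³ → ℂⁿ →L[ℂ] ℂⁿ}
    {P : Fin 3 → ℝ³ → ℂⁿ →L[ℂ] ℂⁿ} {W : ℝ³ → ℂⁿ →L[ℂ] ℂⁿ}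
    (hP : ∀ i, ContDiff ℝ 2 (P i)) (hW : ContDiff ℝ 2 W)
    (hLM : ∀ ψ : ℝ³ → ℂⁿ, Differentiable ℝ ψ →
      Hop L M ψ = fun z => ∑ i, P i z (pd i ψ z) + W z (ψ z))
    {K : ℝ} (hP₀ : ∀ i z, ‖P i z‖ ≤ K * √(‖z‖ ^ 2 + 1)) (hP₁ : ∀ i j z, ‖pd j (P i) z‖ ≤ K)
    (hP₂ : ∀ i j z, ‖pd j (pd j (P i)) z‖ ≤ K)
    (hW₁ : ∀ j z, ‖pd j W z‖ ≤ K * √(‖z‖ ^ 2 + 1)) (hW₂ : ∀ j z, ‖pd j (pd j W) z‖ ≤ K)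
    {φ : ℝ³ → ℂⁿ} (hφ : ContDiff ℝ ∞ φ) (z : ℝ³) :
    ‖Hop L M (H0op φ) z - H0op (Hop L M φ) z‖ ≤
      5 * K * ((∑ i, ∑ j, ‖pd i (pd j φ) z‖) + √(‖z‖ ^ 2 + 1) * (∑ i, ‖pd i φ z‖) +
        √(‖z‖ ^ 2 + 1) ^ 2 * ‖φ z‖) := by
  have hK : 0 ≤ K := (norm_nonneg _).trans (hW₂ 0 z)
  have hs_one : 1 ≤ √(‖z‖ ^ 2 + 1) := Real.one_le_sqrt.2 (by nlinarith [sq_nonneg ‖z‖])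
  rw [commutator_eq hP hW hLM hφ]
  refine (norm_add_le_of_le (norm_sum_le_of_le Finset.univ fun i _ =>
      norm_commutator_term_le (hP₀ i z) (hP₁ i · z) (hP₂ i · z) φ i)
    (norm_add_le_of_le (norm_half_smul_sum_le (by norm_num) fun j =>
        (pd j (pd j W) z).le_of_opNorm_le (hW₂ j z) (φ z))
      (norm_sum_le_of_le Finset.univ fun j _ =>
        (pd j W z).le_of_opNorm_le (hW₁ j z) (pd j φ z)))).trans ?_
  simp only [Finset.sum_add_distrib, ← Finset.mul_sum, Finset.sum_const, Finset.card_univ,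
    Fintype.card_fin, nsmul_eq_mul]
  rw [Finset.sum_comm (f := fun i j => ‖pd j (pd i φ) z‖)]
  have a₂_nonneg : 0 ≤ ∑ i, ∑ j, ‖pd i (pd j φ) z‖ :=
    Finset.sum_nonneg fun i _ => Finset.sum_nonneg fun j _ => norm_nonneg _
  have a₁_nonneg : 0 ≤ ∑ i, ‖pd i φ z‖ := Finset.sum_nonneg fun i _ => norm_nonneg _
  have a₀_nonneg : 0 ≤ ‖φ z‖ := norm_nonneg _
  generalize √(‖z‖ ^ 2 + 1) = s at *
  generalize ∑ i, ∑ j, ‖pd i (pd j φ) z‖ = a₂ at *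
  generalize ∑ i, ‖pd i φ z‖ = a₁ at *
  generalize ‖φ z‖ = a₀ at *
  clear hP hW hLM hP₀ hP₁ hP₂ hW₁ hW₂
  have h₁ : K * a₁ ≤ K * (s * a₁) := by
    gcongr
    exact le_mul_of_one_le_left a₁_nonneg hs_one
  have h₀ : K * a₀ ≤ K * (s ^ 2 * a₀) := by
    gcongr
    exact le_mul_of_one_le_left a₀_nonneg (one_le_pow₀ hs_one)
  have h₂ : 0 ≤ K * a₂ := by positivity
  have h₃ : 0 ≤ K * (s * a₁) := by positivity
  have h₄ : 0 ≤ K * (s ^ 2 * a₀) := by positivity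
  push_cast
  linarith

theorem norm_commutator_sq_le {L : Fin 3 → ℝ³ → ℂⁿ →L[ℂ] ℂⁿ} {M : ℝ³ → ℂⁿ →L[ℂ] ℂⁿ}
    {P : Fin 3 → ℝ³ → ℂⁿ →L[ℂ] ℂⁿ} {W : ℝ³ → ℂⁿ →L[ℂ] ℂⁿ}
    (hP : ∀ i, ContDiff ℝ 2 (P i)) (hW : ContDiff ℝ 2 W)
    (hLM : ∀ ψ : ℝ³ → ℂⁿ, Differentiable ℝ ψ →
      Hop L M ψ = fun z => ∑ i, P i z (pd i ψ z) + W z (ψ z))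
    {K : ℝ} (hP₀ : ∀ i z, ‖P i z‖ ≤ K * √(‖z‖ ^ 2 + 1)) (hP₁ : ∀ i j z, ‖pd j (P i) z‖ ≤ K)
    (hP₂ : ∀ i j z, ‖pd j (pd j (P i)) z‖ ≤ K)
    (hW₁ : ∀ j z, ‖pd j W z‖ ≤ K * √(‖z‖ ^ 2 + 1)) (hW₂ : ∀ j z, ‖pd j (pd j W) z‖ ≤ K)
    {φ : ℝ³ → ℂⁿ} (hφ : ContDiff ℝ ∞ φ) (z : ℝ³) :
    ‖Hop L M (H0op φ) z - H0op (Hop L M φ) z‖ ^ 2 ≤ 675 * K ^ 2 *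
      ((∑ i, ∑ j, ‖pd i (pd j φ) z‖ ^ 2) + (1 + ‖z‖ ^ 2) * ∑ i, ‖pd i φ z‖ ^ 2 +
        (1 + ‖z‖ ^ 2) ^ 2 * ‖φ z‖ ^ 2) := by
  have bound := norm_commutator_le hP hW hLM hP₀ hP₁ hP₂ hW₁ hW₂ hφ z
  set s := √(‖z‖ ^ 2 + 1) with hs
  have hs_sq : s ^ 2 = 1 + ‖z‖ ^ 2 := by rw [hs, Real.sq_sqrt (by positivity)]; ring
  set a₂ := ∑ i, ∑ j, ‖pd i (pd j φ) z‖
  set a₁ := ∑ i, ‖pd i φ z‖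
  have cauchy₁ : a₁ ^ 2 ≤ 3 * ∑ i, ‖pd i φ z‖ ^ 2 := by
    simpa using sq_sum_le_card_mul_sum_sq (s := Finset.univ) (f := fun i => ‖pd i φ z‖)
  have cauchy₂ : a₂ ^ 2 ≤ 9 * ∑ i, ∑ j, ‖pd i (pd j φ) z‖ ^ 2 := by
    have := sq_sum_le_card_mul_sum_sq (s := (Finset.univ : Finset (Fin 3 × Fin 3)))
      (f := fun p => ‖pd p.1 (pd p.2 φ) z‖)
    simp only [Finset.card_univ, Fintype.card_prod, Fintype.card_fin, Fintype.sum_prod_type] at this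
    norm_num at this
    exact this
  calc _ ≤ (5 * K * (a₂ + s * a₁ + s ^ 2 * ‖φ z‖)) ^ 2 := by gcongr
    _ = 25 * K ^ 2 * (a₂ + s * a₁ + s ^ 2 * ‖φ z‖) ^ 2 := by ring
    _ ≤ 25 * K ^ 2 * (3 * (a₂ ^ 2 + s ^ 2 * a₁ ^ 2 + (s ^ 2) ^ 2 * ‖φ z‖ ^ 2)) := by
      gcongr
      nlinarith [sq_nonneg (a₂ - s * a₁), sq_nonneg (a₂ - s ^ 2 * ‖φ z‖),
        sq_nonneg (s * a₁ - s ^ 2 * ‖φ z‖)]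
    _ ≤ 25 * K ^ 2 * (3 * (9 * (∑ i, ∑ j, ‖pd i (pd j φ) z‖ ^ 2) +
          s ^ 2 * (9 * ∑ i, ‖pd i φ z‖ ^ 2) + (s ^ 2) ^ 2 * (9 * ‖φ z‖ ^ 2))) := by
      have : 0 ≤ ∑ i, ‖pd i φ z‖ ^ 2 := by positivity
      gcongr
      · linarith
      · nlinarith [sq_nonneg ‖φ z‖]
    _ = _ := by rw [hs_sq]; ring

theorem sqrt_integral_commutator_le {L : Fin 3 → ℝ³ → ℂⁿ →L[ℂ] ℂⁿ} {M : ℝ³ → ℂⁿ →L[ℂ] ℂⁿ}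
    {P : Fin 3 → ℝ³ → ℂⁿ →L[ℂ] ℂⁿ} {W : ℝ³ → ℂⁿ →L[ℂ] ℂⁿ}
    (hP : ∀ i, ContDiff ℝ 2 (P i)) (hW : ContDiff ℝ 2 W)
    (hLM : ∀ ψ : ℝ³ → ℂⁿ, Differentiable ℝ ψ →
      Hop L M ψ = fun z => ∑ i, P i z (pd i ψ z) + W z (ψ z))
    {K : ℝ} (hP₀ : ∀ i z, ‖P i z‖ ≤ K * √(‖z‖ ^ 2 + 1)) (hP₁ : ∀ i j z, ‖pd j (P i) z‖ ≤ K)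
    (hP₂ : ∀ i j z, ‖pd j (pd j (P i)) z‖ ≤ K)
    (hW₁ : ∀ j z, ‖pd j W z‖ ≤ K * √(‖z‖ ^ 2 + 1)) (hW₂ : ∀ j z, ‖pd j (pd j W) z‖ ≤ K)
    {φ : ℝ³ → ℂⁿ} (hφ : ContDiff ℝ ∞ φ) (hc : HasCompactSupport φ) :
    √(∫ z, ‖Hop L M (H0op φ) z - H0op (Hop L M φ) z‖ ^ 2) ≤
      90 * K * √(∫ z, ‖H0op φ z‖ ^ 2) := by
  have hK : 0 ≤ K := (norm_nonneg _).trans (hW₂ 0 0)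
  have hint : Integrable fun z : ℝ³ => 675 * K ^ 2 *
      ((∑ i, ∑ j, ‖pd i (pd j φ) z‖ ^ 2) + (1 + ‖z‖ ^ 2) * ∑ i, ‖pd i φ z‖ ^ 2 +
        (1 + ‖z‖ ^ 2) ^ 2 * ‖φ z‖ ^ 2) := by
    have c0 : Continuous φ := hφ.continuous
    have c1 : ∀ i, Continuous (pd i φ) := fun i => (contDiff_infty_pd hφ i).continuous
    have c2 : ∀ i j, Continuous (pd i (pd j φ)) := fun i j =>
      (contDiff_infty_pd (contDiff_infty_pd hφ j) i).continuous
    refine integrable_of_eq_zero_off_tsupport hc (by fun_prop) fun z hz => ?_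
    simp [image_eq_zero_of_notMem_tsupport hz, pd_eq_zero_of_notMem_tsupport hz,
      fun i j => pd_eq_zero_of_notMem_tsupport (fun h => hz (tsupport_pd_subset φ j h)) i]
  have h0 : ∀ z : ℝ³, ‖-(∑ i, pd i (pd i φ) z) + ‖z‖ ^ 2 • φ z‖ ^ 2 = 4 * ‖H0op φ z‖ ^ 2 := by
    intro z
    rw [H0op, norm_smul, mul_pow]
    norm_num
    ring
  have graph := integral_graph_norm_le hφ hc
  simp_rw [h0, integral_const_mul] at graph
  have key : ∫ z, ‖Hop L M (H0op φ) z - H0op (Hop L M φ) z‖ ^ 2 ≤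
      (90 * K) ^ 2 * ∫ z, ‖H0op φ z‖ ^ 2 := by
    refine (integral_mono_of_nonneg (.of_forall fun z => by positivity) hint (.of_forall fun z =>
      norm_commutator_sq_le hP hW hLM hP₀ hP₁ hP₂ hW₁ hW₂ hφ z)).trans ?_
    rw [integral_const_mul]
    exact (mul_le_mul_of_nonneg_left graph (by positivity)).trans_eq (by ring)
  refine (Real.sqrt_le_sqrt key).trans_eq ?_
  rw [Real.sqrt_mul (by positivity), Real.sqrt_sq (by positivity)]

end Commutator

/-- Part (iii) of the lemma: with in addition third derivatives of `Lⁱ` and second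
derivatives of `M` bounded, the commutator bound `‖[h, h₀]φ‖ ≤ C₃‖h₀φ‖` holds. -/
theorem stmt_17 (n : ℕ) (hn : 1 ≤ n)
    (L : Fin 3 → EuclideanSpace ℝ (Fin 3) →
      (EuclideanSpace ℂ (Fin n) →L[ℂ] EuclideanSpace ℂ (Fin n)))
    (M : EuclideanSpace ℝ (Fin 3) →
      (EuclideanSpace ℂ (Fin n) →L[ℂ] EuclideanSpace ℂ (Fin n)))
    (hLherm : ∀ i z, IsSelfAdjoint (L i z))
    (hLsm : ∀ i, ContDiff ℝ 3 (L i))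
    (hLb : ∃ CL : ℝ, ∀ i z, ‖L i z‖ ≤ CL * Real.sqrt (‖z‖ ^ 2 + 1))
    (hLd : ∃ CL' : ℝ, ∀ i j z, ‖pd j (L i) z‖ ≤ CL')
    (hLdd : ∃ CL'' : ℝ, ∀ i j k z, ‖pd k (pd j (L i)) z‖ ≤ CL'')
    (hLddd : ∃ CL''' : ℝ, ∀ i j k l z, ‖pd l (pd k (pd j (L i))) z‖ ≤ CL''')
    (hMherm : ∀ z, IsSelfAdjoint (M z))
    (hMsm : ContDiff ℝ 2 M)
    (hMb : ∃ CM : ℝ, ∀ z, ‖M z‖ ≤ CM * (‖z‖ ^ 2 + 1))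
    (hMd : ∃ CM' : ℝ, ∀ i z, ‖pd i M z‖ ≤ CM' * Real.sqrt (‖z‖ ^ 2 + 1))
    (hMdd : ∃ CM'' : ℝ, ∀ i j z, ‖pd j (pd i M) z‖ ≤ CM'') :
    ∃ C₃ : ℝ, ∀ φ : EuclideanSpace ℝ (Fin 3) → EuclideanSpace ℂ (Fin n),
      ContDiff ℝ (⊤ : ℕ∞) φ → HasCompactSupport φ →
        Real.sqrt (∫ z, ‖Hop L M (H0op φ) z - H0op (Hop L M φ) z‖ ^ 2) ≤
          C₃ * Real.sqrt (∫ z, ‖H0op φ z‖ ^ 2) := by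
  obtain ⟨c₀, hc₀⟩ := hLb
  obtain ⟨c₁, hc₁⟩ := hLd
  obtain ⟨c₂, hc₂⟩ := hLdd
  obtain ⟨c₃, hc₃⟩ := hLddd
  obtain ⟨m₁, hm₁⟩ := hMd
  obtain ⟨m₂, hm₂⟩ := hMdd
  let P : Fin 3 → ℝ³ → EuclideanSpace ℂ (Fin n) →L[ℂ] EuclideanSpace ℂ (Fin n) :=
    fun i z => -Complex.I • L i z
  let W : ℝ³ → EuclideanSpace ℂ (Fin n) →L[ℂ] EuclideanSpace ℂ (Fin n) :=
    fun z => M z + (-Complex.I / 2) • ∑ i, pd i (L i) z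
  have hP : ∀ i, ContDiff ℝ 2 (P i) := fun i =>
    ((hLsm i).of_le (by norm_num)).const_smul (-Complex.I)
  have hdL : ∀ i j, ContDiff ℝ 2 (pd j (L i)) := fun i j =>
    contDiff_pd (hLsm i) (by norm_num) j
  have hddL : ∀ i j k, ContDiff ℝ 1 (pd k (pd j (L i))) := fun i j k =>
    contDiff_pd (hdL i j) (by norm_num) k
  have hsum : ContDiff ℝ 2 fun z => ∑ i, pd i (L i) z := ContDiff.sum fun i _ => hdL i i
  have hW : ContDiff ℝ 2 W := hMsm.add (hsum.const_smul _)
  have hLM : ∀ ψ : ℝ³ → EuclideanSpace ℂ (Fin n), Differentiable ℝ ψ →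
      Hop L M ψ = fun z => ∑ i, P i z (pd i ψ z) + W z (ψ z) := fun ψ hψ =>
    funext (Hop_eq_sum_add (fun i => (hLsm i).differentiable (by norm_num)) hψ)
  have dP : ∀ i j, pd j (P i) = fun z => -Complex.I • pd j (L i) z := fun i j =>
    pd_const_smul ((hLsm i).differentiable (by norm_num)) _ j
  have ddP : ∀ i j, pd j (pd j (P i)) = fun z => -Complex.I • pd j (pd j (L i)) z := fun i j => by
    rw [dP]
    exact pd_const_smul ((hdL i j).differentiable (by norm_num)) _ j
  have dW : ∀ j, pd j W = fun z => pd j M z + (-Complex.I / 2) • ∑ i, pd j (pd i (L i)) z := by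
    intro j
    refine (pd_add (hMsm.differentiable (by norm_num))
      ((hsum.const_smul (-Complex.I / 2)).differentiable (by norm_num)) j).trans ?_
    rw [pd_const_smul (hsum.differentiable (by norm_num)),
      pd_sum _ fun i => (hdL i i).differentiable (by norm_num)]
  have hdsum : ∀ j, ContDiff ℝ 1 fun z => ∑ i, pd j (pd i (L i)) z := fun j =>
    ContDiff.sum fun i _ => hddL i i j
  have ddW : ∀ j, pd j (pd j W) =
      fun z => pd j (pd j M) z + (-Complex.I / 2) • ∑ i, pd j (pd j (pd i (L i))) z := by
    intro j
    rw [dW, pd_add ((contDiff_pd (m := 1) hMsm (by norm_num) j).differentiable (by norm_num))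
      (((hdsum j).const_smul _).differentiable (by norm_num)),
      pd_const_smul ((hdsum j).differentiable (by norm_num)),
      pd_sum _ fun i => (hddL i i j).differentiable (by norm_num)]
  obtain ⟨K, hK⟩ : ∃ K, K = |c₀| + |c₁| + 2 * |c₂| + 2 * |c₃| + |m₁| + |m₂| := ⟨_, rfl⟩
  have hs : ∀ z : ℝ³, 1 ≤ √(‖z‖ ^ 2 + 1) := fun z =>
    Real.one_le_sqrt.2 (by nlinarith [sq_nonneg ‖z‖])
  have := abs_nonneg c₀
  have := abs_nonneg c₁
  have := abs_nonneg c₂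
  have := abs_nonneg c₃
  have := abs_nonneg m₁
  have := abs_nonneg m₂
  have := le_abs_self c₀
  have := le_abs_self c₁
  have := le_abs_self c₂
  have := le_abs_self c₃
  have := le_abs_self m₁
  have := le_abs_self m₂
  have hP₀ : ∀ i z, ‖P i z‖ ≤ K * √(‖z‖ ^ 2 + 1) := fun i z => by
    simp only [P, norm_smul, norm_neg, Complex.norm_I, one_mul]
    refine (hc₀ i z).trans ?_
    gcongr
    linarith
  have hP₁ : ∀ i j z, ‖pd j (P i) z‖ ≤ K := fun i j z => by
    simp only [dP, norm_smul, norm_neg, Complex.norm_I, one_mul]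
    linarith [hc₁ i j z]
  have hP₂ : ∀ i j z, ‖pd j (pd j (P i)) z‖ ≤ K := fun i j z => by
    simp only [ddP, norm_smul, norm_neg, Complex.norm_I, one_mul]
    linarith [hc₂ i j j z]
  have hW₁ : ∀ j z, ‖pd j W z‖ ≤ K * √(‖z‖ ^ 2 + 1) := fun j z => by
    rw [dW]
    refine (norm_add_le_of_le (hm₁ j z)
      (norm_half_smul_sum_le (by simp) fun i => hc₂ i i j z)).trans ?_
    nlinarith [hs z]
  have hW₂ : ∀ j z, ‖pd j (pd j W) z‖ ≤ K := fun j z => by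
    rw [ddW]
    refine (norm_add_le_of_le (hm₂ j j z)
      (norm_half_smul_sum_le (by simp) fun i => hc₃ i i j j z)).trans ?_
    linarith
  exact ⟨90 * K, fun φ hφ hc => sqrt_integral_commutator_le hP hW hLM hP₀ hP₁ hP₂ hW₁ hW₂ hφ hc⟩

end
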